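/- arXiv:1711.06215 — 4 statements merged into one kernel-verified Lean document; each statement's English description precedes it below -/
import Mathlib

section
/- Let G be a shelf and, for n ≥ 1, define maps dᵢ⁺, dᵢ⁻ : Gⁿ → Gⁿ⁻¹ for 1 ≤ i ≤ n by dᵢ⁺(g₁,…,gₙ) = (g₁◁gᵢ,…,gᵢ₋₁◁gᵢ, gᵢ₊₁,…,gₙ) and dᵢ⁻(g₁,…,gₙ) = (g₁,…,gᵢ₋₁, gᵢ₊₁,…,gₙ). Then these maps satisfy the pre-cubical identities dᵢᵉ ∘ dⱼᶻ = dⱼ₋₁ᶻ ∘ dᵢᵉ : Gⁿ → Gⁿ⁻² for all 1 ≤ i < j ≤ n and all signs ε, ζ ∈ {+,−}. -/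
/-- The cubical face map `dᵢ⁺ : Gⁿ → Gⁿ⁻¹` (`1 ≤ i ≤ n`), with tuples encoded as lists:
`dᵢ⁺(g₁,…,gₙ) = (g₁◁gᵢ, …, gᵢ₋₁◁gᵢ, gᵢ₊₁, …, gₙ)` where `◁ = act`. -/
def cubeFacePlus {G : Type*} (act : G → G → G) : ℕ → List G → List G
  | _, [] => []
  | 0, l => l
  | 1, _ :: l => l
  | i + 2, a :: l => act a (l.getD i a) :: cubeFacePlus act (i + 1) l

/-- The cubical face map `dᵢ⁻ : Gⁿ → Gⁿ⁻¹` (`1 ≤ i ≤ n`), with tuples encoded as lists: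
`dᵢ⁻(g₁,…,gₙ) = (g₁, …, gᵢ₋₁, gᵢ₊₁, …, gₙ)`. -/
def cubeFaceMinus {G : Type*} (i : ℕ) (l : List G) : List G := l.eraseIdx (i - 1)

/-- The cubical face map `dᵢᵉ` with sign `ε` (`true` for `+`, `false` for `−`). -/
def cubeFace {G : Type*} (act : G → G → G) (ε : Bool) (i : ℕ) (l : List G) : List G :=
  if ε then cubeFacePlus act i l else cubeFaceMinus i l

theorem cubeFace_one_cons {G : Type*} (act : G → G → G) (ε : Bool) (a : G) (l : List G) :
    cubeFace act ε 1 (a :: l) = l := by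
  cases ε <;> simp [cubeFace, cubeFacePlus, cubeFaceMinus]

theorem cubeFace_add_two_cons {G : Type*} (act : G → G → G) (ε : Bool) (i : ℕ) (a : G)
    (l : List G) :
    cubeFace act ε (i + 2) (a :: l) =
      (if ε then act a (l.getD i a) else a) :: cubeFace act ε (i + 1) l := by
  cases ε <;> simp [cubeFace, cubeFacePlus, cubeFaceMinus]

/-- Entries before the removed one are acted on by it (for the sign `+`) or kept. -/
theorem getD_cubeFace_of_lt {G : Type*} (act : G → G → G) (ε : Bool) (d d' : G) (l : List G)
    (k i : ℕ) (hk : k < i) (hi : i < l.length) :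
    (cubeFace act ε (i + 1) l).getD k d =
      if ε then act (l.getD k d') (l.getD i d') else l.getD k d' := by
  induction l generalizing k i with
  | nil => simp at hi
  | cons a l ih =>
    obtain ⟨i, rfl⟩ : ∃ m, i = m + 1 := ⟨i - 1, by omega⟩
    have hi' : i < l.length := by simpa using hi
    rw [cubeFace_add_two_cons]
    cases k with
    | zero => simp [hi']
    | succ k => simpa only [List.getD_cons_succ] using ih k i (by omega) hi'

/-- Entries after the removed one are shifted by one place. -/
theorem getD_cubeFace_of_le {G : Type*} (act : G → G → G) (ε : Bool) (d d' : G) (l : List G)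
    (k i : ℕ) (hk : i ≤ k) (hl : k + 1 < l.length) :
    (cubeFace act ε (i + 1) l).getD k d = l.getD (k + 1) d' := by
  induction l generalizing k i with
  | nil => simp at hl
  | cons a l ih =>
    have hl' : k < l.length := by simpa using hl
    cases i with
    | zero => simp [cubeFace_one_cons, hl']
    | succ i =>
      obtain ⟨k, rfl⟩ : ∃ m, k = m + 1 := ⟨k - 1, by omega⟩
      rw [cubeFace_add_two_cons]
      simpa only [List.getD_cons_succ] using ih k i (by omega) hl'

/-- The pre-cubical identities with zero-based indices. -/
theorem cubeFace_comm {G : Type*} (act : G → G → G)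
    (selfDistrib : ∀ a b c : G, act (act a b) c = act (act a c) (act b c))
    (ε ζ : Bool) (l : List G) (p q : ℕ) (hpq : p ≤ q) (hq : q + 1 < l.length) :
    cubeFace act ε (p + 1) (cubeFace act ζ (q + 2) l) =
      cubeFace act ζ (q + 1) (cubeFace act ε (p + 1) l) := by
  induction l generalizing p q with
  | nil => simp at hq
  | cons a l ih =>
    have hq' : q < l.length := by simpa using hq
    cases p with
    | zero => simp [cubeFace_add_two_cons, cubeFace_one_cons]
    | succ p =>
      obtain ⟨q, rfl⟩ : ∃ m, q = m + 1 := ⟨q - 1, by omega⟩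
      rw [cubeFace_add_two_cons act ζ, cubeFace_add_two_cons act ε,
        cubeFace_add_two_cons act ε, cubeFace_add_two_cons act ζ, ih p q (by omega) hq',
        getD_cubeFace_of_lt act ζ _ a l p (q + 1) (by omega) hq',
        getD_cubeFace_of_le act ε _ a l q p (by omega) hq']
      cases ε <;> cases ζ <;> simp [← selfDistrib]

/-- For a shelf `G`, the face maps `dᵢ⁺, dᵢ⁻ : Gⁿ → Gⁿ⁻¹` satisfy the pre-cubical
identities `dᵢᵉ ∘ dⱼᶻ = dⱼ₋₁ᶻ ∘ dᵢᵉ` for `1 ≤ i < j ≤ n` and all signs `ε, ζ`. -/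
theorem precubical_identities_of_shelf {G : Type*} (act : G → G → G)
    (selfDistrib : ∀ a b c : G, act (act a b) c = act (act a c) (act b c))
    (n : ℕ) (l : List G) (hl : l.length = n)
    (i j : ℕ) (hi : 1 ≤ i) (hij : i < j) (hj : j ≤ n) (ε ζ : Bool) :
    cubeFace act ε i (cubeFace act ζ j l) = cubeFace act ζ (j - 1) (cubeFace act ε i l) := by
  obtain ⟨p, rfl⟩ : ∃ m, i = m + 1 := ⟨i - 1, by omega⟩
  obtain ⟨q, rfl⟩ : ∃ m, j = m + 2 := ⟨j - 2, by omega⟩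
  exact cubeFace_comm act selfDistrib ε ζ l p q (by omega) (by omega)
end

section
/- Let G be a shelf, and for n ≥ 1 let ∂ₙ : ℤ[Gⁿ] → ℤ[Gⁿ⁻¹] be the ℤ-linear map defined on generators by ∂ₙ(g₁,…,gₙ) = Σᵢ₌₁ⁿ (−1)ⁱ [dᵢ⁺(g₁,…,gₙ) − dᵢ⁻(g₁,…,gₙ)], where dᵢ⁺(g₁,…,gₙ) = (g₁◁gᵢ,…,gᵢ₋₁◁gᵢ, gᵢ₊₁,…,gₙ) and dᵢ⁻(g₁,…,gₙ) = (g₁,…,gᵢ₋₁, gᵢ₊₁,…,gₙ). Then ∂ₙ₋₁ ∘ ∂ₙ = 0 for all n ≥ 2. -/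
/-- The cubical (rack) boundary, as a homomorphism of free abelian groups
(`ℤ[S]` is encoded as `S →₀ ℤ`): a generator `(g₁,…,gₙ)` is sent to
`Σᵢ₌₁ⁿ (−1)ⁱ [dᵢ⁺(g₁,…,gₙ) − dᵢ⁻(g₁,…,gₙ)]`. -/
noncomputable def cubeBoundary {G : Type*} (act : G → G → G) :
    (List G →₀ ℤ) →+ (List G →₀ ℤ) :=
  Finsupp.liftAddHom fun l =>
    zmultiplesHom _ (∑ i ∈ Finset.range l.length,
      ((-1 : ℤ) ^ (i + 1)) •
        (Finsupp.single (cubeFacePlus act (i + 1) l) (1 : ℤ)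
          - Finsupp.single (cubeFaceMinus (i + 1) l) (1 : ℤ)))

section Faces

variable {G : Type*} (act : G → G → G)

theorem cubeFacePlus_one_cons (a : G) (l : List G) : cubeFacePlus act 1 (a :: l) = l := by
  simp [cubeFacePlus]

theorem cubeFacePlus_add_two_cons (i : ℕ) (a : G) (l : List G) :
    cubeFacePlus act (i + 2) (a :: l) = act a (l.getD i a) :: cubeFacePlus act (i + 1) l := by
  simp [cubeFacePlus]

theorem cubeFaceMinus_one_cons (a : G) (l : List G) : cubeFaceMinus 1 (a :: l) = l := by
  simp [cubeFaceMinus]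

theorem cubeFaceMinus_add_two_cons (i : ℕ) (a : G) (l : List G) :
    cubeFaceMinus (i + 2) (a :: l) = a :: cubeFaceMinus (i + 1) l := by
  simp [cubeFaceMinus]

theorem length_cubeFacePlus (l : List G) (i : ℕ) (hi : i < l.length) :
    (cubeFacePlus act (i + 1) l).length = l.length - 1 := by
  induction l generalizing i with
  | nil => simp at hi
  | cons a l ih =>
    cases i with
    | zero => simp [cubeFacePlus_one_cons]
    | succ i =>
      have hi' : i < l.length := by simpa using hi
      simp only [cubeFacePlus_add_two_cons, List.length_cons, ih i hi']
      lia

theorem length_cubeFaceMinus (l : List G) (i : ℕ) (hi : i < l.length) :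
    (cubeFaceMinus (i + 1) l).length = l.length - 1 := by
  simp [cubeFaceMinus, List.length_eraseIdx, hi]

theorem getD_eq_getD_of_lt (l : List G) {k : ℕ} (hk : k < l.length) (d d' : G) :
    l.getD k d = l.getD k d' := by
  simp [hk]

theorem getD_cubeFacePlus_of_lt (l : List G) {i k : ℕ} (hk : k < i) (hi : i < l.length)
    (d d' d'' : G) :
    (cubeFacePlus act (i + 1) l).getD k d = act (l.getD k d') (l.getD i d'') := by
  induction l generalizing i k with
  | nil => simp at hi
  | cons a l ih =>
    obtain ⟨i, rfl⟩ : ∃ m, i = m + 1 := ⟨i - 1, by lia⟩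
    have hi' : i < l.length := by simpa using hi
    rw [cubeFacePlus_add_two_cons]
    cases k with
    | zero =>
      rw [List.getD_cons_zero, List.getD_cons_zero, List.getD_cons_succ,
        getD_eq_getD_of_lt l hi' a d'']
    | succ k =>
      simp only [List.getD_cons_succ]
      exact ih (by lia) hi'

theorem getD_cubeFacePlus_of_le (l : List G) {i k : ℕ} (hk : i ≤ k) (d : G) :
    (cubeFacePlus act (i + 1) l).getD k d = l.getD (k + 1) d := by
  induction l generalizing i k with
  | nil => simp [cubeFacePlus]
  | cons a l ih =>
    cases i with
    | zero => simp [cubeFacePlus_one_cons]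
    | succ i =>
      obtain ⟨k, rfl⟩ : ∃ m, k = m + 1 := ⟨k - 1, by lia⟩
      rw [cubeFacePlus_add_two_cons, List.getD_cons_succ, List.getD_cons_succ, ih (by lia)]

theorem getD_cubeFaceMinus_of_lt (l : List G) {i k : ℕ} (hk : k < i) (d : G) :
    (cubeFaceMinus (i + 1) l).getD k d = l.getD k d := by
  simp [cubeFaceMinus, List.getD_eq_getElem?_getD, List.getElem?_eraseIdx, hk]

theorem getD_cubeFaceMinus_of_le (l : List G) {i k : ℕ} (hk : i ≤ k) (d : G) :
    (cubeFaceMinus (i + 1) l).getD k d = l.getD (k + 1) d := by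
  simp [cubeFaceMinus, List.getD_eq_getElem?_getD, List.getElem?_eraseIdx, hk.not_gt]

theorem cubeFacePlus_cubeFacePlus
    (selfDistrib : ∀ a b c : G, act (act a b) c = act (act a c) (act b c))
    (l : List G) {i j : ℕ} (hij : i ≤ j) (hj : j + 1 < l.length) :
    cubeFacePlus act (i + 1) (cubeFacePlus act (j + 2) l) =
      cubeFacePlus act (j + 1) (cubeFacePlus act (i + 1) l) := by
  induction l generalizing i j with
  | nil => simp at hj
  | cons a l ih =>
    have hj' : j < l.length := by simpa using hj
    cases i with
    | zero => simp only [zero_add, cubeFacePlus_add_two_cons, cubeFacePlus_one_cons]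
    | succ i =>
      obtain ⟨j, rfl⟩ : ∃ m, j = m + 1 := ⟨j - 1, by lia⟩
      simp only [cubeFacePlus_add_two_cons]
      rw [ih (by lia) hj', getD_cubeFacePlus_of_lt act l (by lia) hj' _ a a,
        getD_cubeFacePlus_of_le act l (by lia), ← selfDistrib,
        getD_eq_getD_of_lt l hj' a (act a (l.getD i a))]

theorem cubeFacePlus_cubeFaceMinus (l : List G) {i j : ℕ} (hij : i ≤ j) (hj : j + 1 < l.length) :
    cubeFacePlus act (i + 1) (cubeFaceMinus (j + 2) l) =
      cubeFaceMinus (j + 1) (cubeFacePlus act (i + 1) l) := by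
  induction l generalizing i j with
  | nil => simp at hj
  | cons a l ih =>
    have hj' : j < l.length := by simpa using hj
    cases i with
    | zero => simp only [zero_add, cubeFaceMinus_add_two_cons, cubeFacePlus_one_cons]
    | succ i =>
      obtain ⟨j, rfl⟩ : ∃ m, j = m + 1 := ⟨j - 1, by lia⟩
      simp only [cubeFacePlus_add_two_cons, cubeFaceMinus_add_two_cons]
      rw [ih (by lia) hj', getD_cubeFaceMinus_of_lt l (by lia)]

theorem cubeFaceMinus_cubeFacePlus (l : List G) {i j : ℕ} (hij : i ≤ j) (hj : j + 1 < l.length) :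
    cubeFaceMinus (i + 1) (cubeFacePlus act (j + 2) l) =
      cubeFacePlus act (j + 1) (cubeFaceMinus (i + 1) l) := by
  induction l generalizing i j with
  | nil => simp at hj
  | cons a l ih =>
    have hj' : j < l.length := by simpa using hj
    cases i with
    | zero => simp only [zero_add, cubeFacePlus_add_two_cons, cubeFaceMinus_one_cons]
    | succ i =>
      obtain ⟨j, rfl⟩ : ∃ m, j = m + 1 := ⟨j - 1, by lia⟩
      simp only [cubeFacePlus_add_two_cons, cubeFaceMinus_add_two_cons]
      rw [ih (by lia) hj', getD_cubeFaceMinus_of_le l (by lia)]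

theorem cubeFaceMinus_cubeFaceMinus (l : List G) {i j : ℕ} (hij : i ≤ j) :
    cubeFaceMinus (i + 1) (cubeFaceMinus (j + 2) l) =
      cubeFaceMinus (j + 1) (cubeFaceMinus (i + 1) l) := by
  induction l generalizing i j with
  | nil => simp [cubeFaceMinus]
  | cons a l ih =>
    cases i with
    | zero => simp only [zero_add, cubeFaceMinus_add_two_cons, cubeFaceMinus_one_cons]
    | succ i =>
      obtain ⟨j, rfl⟩ : ∃ m, j = m + 1 := ⟨j - 1, by lia⟩
      simp only [cubeFaceMinus_add_two_cons]
      rw [ih (by lia)]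

end Faces

/-- A double alternating sum whose terms satisfy the (pre)simplicial identity vanishes. -/
theorem sum_sum_alternating_eq_zero {M : Type*} [AddCommGroup M] (n : ℕ) (f : ℕ → ℕ → M)
    (hf : ∀ i j, i ≤ j → j < n → f i (j + 1) = f j i) :
    ∑ j ∈ Finset.range (n + 1), ∑ i ∈ Finset.range n,
      ((-1 : ℤ) ^ (j + 1) * (-1 : ℤ) ^ (i + 1)) • f i j = 0 := by
  induction n with
  | zero => simp
  | succ n ih =>
    rw [Finset.sum_range_succ, Finset.sum_congr rfl fun j _ => Finset.sum_range_succ _ n,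
      Finset.sum_add_distrib, ih fun i j hij hj => hf i j hij (by lia), zero_add,
      ← Finset.sum_add_distrib]
    refine Finset.sum_eq_zero fun i hi => ?_
    rw [hf i n (by simpa [Nat.lt_succ_iff] using hi) (by lia), ← add_smul]
    convert zero_smul ℤ (f n i) using 2
    ring

theorem cubeBoundary_single {G : Type*} (act : G → G → G) (l : List G) :
    cubeBoundary act (Finsupp.single l 1) =
      ∑ i ∈ Finset.range l.length, ((-1 : ℤ) ^ (i + 1)) •
        (Finsupp.single (cubeFacePlus act (i + 1) l) (1 : ℤ)
          - Finsupp.single (cubeFaceMinus (i + 1) l) (1 : ℤ)) := by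
  simp [cubeBoundary]

theorem cubeBoundary_cubeBoundary_single {G : Type*} (act : G → G → G)
    (selfDistrib : ∀ a b c : G, act (act a b) c = act (act a c) (act b c)) (l : List G) :
    cubeBoundary act (cubeBoundary act (Finsupp.single l 1)) = 0 := by
  obtain hl | ⟨n, hn⟩ : l.length = 0 ∨ ∃ n, l.length = n + 1 := by
    cases l <;> simp
  · simp [cubeBoundary_single act l, hl]
  let D : ℕ → List G → List G →₀ ℤ := fun i l =>
    Finsupp.single (cubeFacePlus act (i + 1) l) 1 - Finsupp.single (cubeFaceMinus (i + 1) l) 1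
  rw [← sum_sum_alternating_eq_zero n
    (fun i j => D i (cubeFacePlus act (j + 1) l) - D i (cubeFaceMinus (j + 1) l))
    fun i j hij hj => ?_, cubeBoundary_single, map_sum, hn]
  · refine Finset.sum_congr rfl fun j hj => ?_
    have hj' : j < l.length := by simpa [hn] using hj
    rw [map_zsmul, map_sub, cubeBoundary_single, cubeBoundary_single,
      length_cubeFacePlus act l j hj', length_cubeFaceMinus l j hj', hn, Nat.add_sub_cancel,
      ← Finset.sum_sub_distrib, Finset.smul_sum]
    simp only [D, ← smul_sub, smul_smul]
  · have hj' : j + 1 < l.length := by lia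
    simp only [D]
    rw [cubeFacePlus_cubeFacePlus act selfDistrib l hij hj',
      cubeFacePlus_cubeFaceMinus act l hij hj', cubeFaceMinus_cubeFacePlus act l hij hj',
      cubeFaceMinus_cubeFaceMinus l hij]
    abel

/-- For a shelf `G`, the cubical boundary satisfies `∂ₙ₋₁ ∘ ∂ₙ = 0`
on `ℤ[Gⁿ]` for `n ≥ 2`. -/
theorem cubical_boundary_squared_eq_zero {G : Type*} (act : G → G → G)
    (selfDistrib : ∀ a b c : G, act (act a b) c = act (act a c) (act b c))
    (n : ℕ) (hn : 2 ≤ n) (x : List G →₀ ℤ)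
    (hx : ∀ l ∈ x.support, l.length = n) :
    cubeBoundary act (cubeBoundary act x) = 0 := by
  suffices h : (cubeBoundary act).comp (cubeBoundary act) = 0 from DFunLike.congr_fun h x
  refine Finsupp.addHom_ext' fun l => AddMonoidHom.ext_int ?_
  simpa using cubeBoundary_cubeBoundary_single act selfDistrib l
end

section
/- Let G be a set with two binary operations · and ◁ (no axioms assumed). For all a,b,c ∈ G, consider the element of the free abelian group ℤ[G] obtained by applying the degree-2 boundary termwise to the degree-3 prismatic boundary ∂((a,b)|c) = b|c − (a·b)|c + a|c + (a◁c, b◁c) − (a,b), namely [b − b◁c] − [(a·b) − (a·b)◁c] + [a − a◁c] + [(b◁c) − (a◁c)·(b◁c) + (a◁c)] − [b − a·b + a]. This element equals zero for all a,b,c ∈ G if and only if axiom (YI), (a·b)◁c = (a◁c)·(b◁c), holds for all a,b,c ∈ G. -/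
/-- Applying the degree-2 prismatic boundary termwise to
`∂((a,b)|c) = b|c − (a·b)|c + a|c + (a◁c, b◁c) − (a,b)` yields zero in `ℤ[G]`
for all `a, b, c` if and only if axiom (YI) holds. Here `ℤ[G]` is encoded as
`G →₀ ℤ`, with `∂(x,y) = y − x·y + x` and `∂(x|y) = x − x◁y`. -/
theorem boundary_of_triangular_prism_zero_iff_YI {G : Type*} (mul act : G → G → G) :
    (∀ a b c : G,
        (Finsupp.single b (1 : ℤ) - Finsupp.single (act b c) 1)
        - (Finsupp.single (mul a b) 1 - Finsupp.single (act (mul a b) c) 1)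
        + (Finsupp.single a 1 - Finsupp.single (act a c) 1)
        + (Finsupp.single (act b c) 1 - Finsupp.single (mul (act a c) (act b c)) 1
            + Finsupp.single (act a c) 1)
        - (Finsupp.single b 1 - Finsupp.single (mul a b) 1 + Finsupp.single a 1)
        = (0 : G →₀ ℤ))
    ↔ (∀ a b c : G, act (mul a b) c = mul (act a c) (act b c)) := by
  refine forall_congr' fun a => forall_congr' fun b => forall_congr' fun c => ?_
  rw [← Finsupp.single_left_inj (a := act (mul a b) c) (one_ne_zero : (1 : ℤ) ≠ 0),
    ← sub_eq_zero (a := Finsupp.single (act (mul a b) c) (1 : ℤ))]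
  refine Eq.congr_left ?_
  abel
end

section
/- Let G be a shalgebra. For all a,b,c,d ∈ G, applying the degree-3 prismatic boundary formulas termwise to the degree-4 prismatic boundary ∂((a,b)|(c,d)) = b|(c,d) − (a·b)|(c,d) + a|(c,d) + (a◁c, b◁c)|d − (a,b)|(c·d) + (a,b)|c yields zero in the degree-2 prismatic chain group ℤ[G×G] ⊕ ℤ[G×G]; that is, ∂₃(∂₄((a,b)|(c,d))) = 0. -/
/-- The degree-2 prismatic chain group `ℤ[G×G] ⊕ ℤ[G×G]`, encoded as the free
abelian group on two disjoint copies of `G × G`: `Sum.inl (x,y)` is the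
simplex-type generator `(x,y)` and `Sum.inr (x,y)` is the square-type generator `x|y`. -/
abbrev PrismChain2 (G : Type*) : Type _ := ((G × G) ⊕ (G × G)) →₀ ℤ

/-- The degree-3 prismatic boundary of the triangular-prism generator `(x,y)|z`:
`∂((x,y)|z) = y|z − (x·y)|z + x|z + (x◁z, y◁z) − (x,y)`. -/
noncomputable def triBoundary {G : Type*} (mul act : G → G → G) (x y z : G) :
    PrismChain2 G :=
  Finsupp.single (Sum.inr (y, z)) 1
    - Finsupp.single (Sum.inr (mul x y, z)) 1
    + Finsupp.single (Sum.inr (x, z)) 1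
    + Finsupp.single (Sum.inl (act x z, act y z)) 1
    - Finsupp.single (Sum.inl (x, y)) 1

/-- The degree-3 prismatic boundary of the prism generator `x|(y,z)` (after the
cancellation `(y,z) − (y,z)`): `∂(x|(y,z)) = −(x◁y)|z + x|(y·z) − x|y`. -/
noncomputable def sqBoundary {G : Type*} (mul act : G → G → G) (x y z : G) :
    PrismChain2 G :=
  -Finsupp.single (Sum.inr (act x y, z)) 1
    + Finsupp.single (Sum.inr (x, mul y z)) 1
    - Finsupp.single (Sum.inr (x, y)) 1

/-- For a shalgebra `G`, applying the degree-3 prismatic boundary termwise to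
`∂((a,b)|(c,d)) = b|(c,d) − (a·b)|(c,d) + a|(c,d) + (a◁c, b◁c)|d − (a,b)|(c·d) + (a,b)|c`
yields zero in the degree-2 prismatic chain group: `∂₃(∂₄((a,b)|(c,d))) = 0`. -/
theorem boundary_squared_zero_on_prism_2_2 {G : Type*} (mul act : G → G → G)
    (hH : ∀ a b c : G, mul (mul a b) c = mul a (mul b c))
    (hYI : ∀ a b c : G, act (mul a b) c = mul (act a c) (act b c))
    (hIY : ∀ a b c : G, act (act a b) c = act a (mul b c))
    (hIII : ∀ a b c : G, act (act a b) c = act (act a c) (act b c))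
    (a b c d : G) :
    sqBoundary mul act b c d
      - sqBoundary mul act (mul a b) c d
      + sqBoundary mul act a c d
      + triBoundary mul act (act a c) (act b c) d
      - triBoundary mul act a b (mul c d)
      + triBoundary mul act a b c
      = 0 := by
  simp only [sqBoundary, triBoundary, hYI, hIY]
  abel
end
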